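/- arXiv:2002.07177 — 2 statements merged into one kernel-verified Lean document; each statement's English description precedes it below -/
import Mathlib

section
/- Fix real numbers α, A, a₁₂¹, a₁₂², a₁₃¹, a₁₃², a₂₃¹, a₂₃², a linear functional c on ℝ³, and a vector v = (v₁, v₂, v₃) ∈ ℝ³ satisfying cos α · v₁ + sin α · v₂ − A · v₃ = 0. With Θ₂ᴸ³ defined as Θ₂ᴸ³ = −(A/L)·(c + ω₁ᴸ²) + (1/√L)·(−sin α · ω₁ᴸ³ + cos α · ω₂ᴸ³), where ω₁ᴸ² = −a₁₂¹ e¹ − a₁₂² e² + ((a₂₃¹ − a₁₃² − L)/2) e³, ω₁ᴸ³ = −(a₁₃¹/√L) e¹ − ((a₁₃² + a₂₃¹ + L)/(2√L)) e², ω₂ᴸ³ = ((−a₁₃² − a₂₃¹ + L)/(2√L)) e¹ − (a₂₃²/√L) e², the limit lim_{L→∞} Θ₂ᴸ³(v) exists and equals A · v₃. -/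
open Filter Topology

/-- For tangent vectors `v` (i.e. `cos α v₁ + sin α v₂ − A v₃ = 0`), the limit
`lim_{L→∞} Θ₂ᴸ³(v)` exists and equals `A · v₃`. -/
theorem limit_Theta_on_tangent (α A a121 a122 a131 a132 a231 a232 : ℝ)
    (c : (Fin 3 → ℝ) →L[ℝ] ℝ) (v : Fin 3 → ℝ)
    (hv : Real.cos α * v 0 + Real.sin α * v 1 - A * v 2 = 0) :
    let e1 : (Fin 3 → ℝ) →L[ℝ] ℝ := ContinuousLinearMap.proj 0
    let e2 : (Fin 3 → ℝ) →L[ℝ] ℝ := ContinuousLinearMap.proj 1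
    let e3 : (Fin 3 → ℝ) →L[ℝ] ℝ := ContinuousLinearMap.proj 2
    let ω12 : ℝ → (Fin 3 → ℝ) →L[ℝ] ℝ := fun L =>
      (-a121) • e1 + (-a122) • e2 + ((a231 - a132 - L) / 2) • e3
    let ω13 : ℝ → (Fin 3 → ℝ) →L[ℝ] ℝ := fun L =>
      (-(a131 / Real.sqrt L)) • e1 +
        (-((a132 + a231 + L) / (2 * Real.sqrt L))) • e2
    let ω23 : ℝ → (Fin 3 → ℝ) →L[ℝ] ℝ := fun L =>
      ((-a132 - a231 + L) / (2 * Real.sqrt L)) • e1 +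
        (-(a232 / Real.sqrt L)) • e2
    let Θ : ℝ → (Fin 3 → ℝ) →L[ℝ] ℝ := fun L =>
      (-(A / L)) • (c + ω12 L) +
        (1 / Real.sqrt L) • ((-Real.sin α) • ω13 L + Real.cos α • ω23 L)
    Tendsto (fun L => Θ L v) atTop (𝓝 (A * v 2)) := by
  intro e1 e2 e3 ω12 ω13 ω23 Θ
  set K : ℝ := -A * (c v - a121 * v 0 - a122 * v 1 + (a231 - a132) / 2 * v 2) +
    (Real.sin α * (a131 * v 0 + (a132 + a231) / 2 * v 1) +
      Real.cos α * ((-a132 - a231) / 2 * v 0 - a232 * v 1)) with hK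
  have key : ∀ᶠ L in atTop, A * v 2 + K / L = Θ L v := by
    filter_upwards [eventually_gt_atTop 0] with L hL
    obtain ⟨s, hs, rfl⟩ : ∃ s : ℝ, 0 < s ∧ L = s ^ 2 :=
      ⟨√L, Real.sqrt_pos.2 hL, (Real.sq_sqrt hL.le).symm⟩
    simp only [Θ, ω12, ω13, ω23, e1, e2, e3, add_apply, smul_apply, smul_eq_mul,
      ContinuousLinearMap.proj_apply, Real.sqrt_sq hs.le, hK]
    field_simp
    linear_combination (-s ^ 2) * hv
  refine Tendsto.congr' key ?_
  simpa using (tendsto_const_nhds (x := A * v 2)).add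
    (tendsto_const_nhds (x := K).div_atTop tendsto_id)
end

section
/- Let x, y, A : ℝ → ℝ be functions differentiable at a point t₀ with y(t₀) ≠ 0. For each L > 0, define xᴸ(s) = x(s)/√(x(s)² + y(s)²·(L + A(s)²)) and yᴸ(s) = y(s)·√(L + A(s)²)/√(x(s)² + y(s)²·(L + A(s)²)). Then the expression −yᴸ(t₀)·(d/ds xᴸ)(t₀) + xᴸ(t₀)·(d/ds yᴸ)(t₀) tends to 0 as L → ∞. -/
open Filter Topology

/-- The Wronskian-type expression of `u / r` and `v / r` does not involve the derivative of `r`. -/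
theorem wronskian_div_div {u v r : ℝ → ℝ} {u' v' r' t : ℝ}
    (hu : HasDerivAt u u' t) (hv : HasDerivAt v v' t) (hr : HasDerivAt r r' t) (hr0 : r t ≠ 0) :
    -(v t / r t) * deriv (fun s => u s / r s) t + u t / r t * deriv (fun s => v s / r s) t =
      (u t * v' - v t * u') / r t ^ 2 := by
  rw [(hu.fun_div hr hr0).deriv, (hv.fun_div hr hr0).deriv]
  field_simp
  ring

theorem tendsto_add_div_div_quadratic_atTop (c d a : ℝ) {b : ℝ} (hb : 0 < b) :
    Tendsto (fun q : ℝ => (c * q + d / q) / (a + b * q ^ 2)) atTop (𝓝 0) := by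
  have hnum : Tendsto (fun q : ℝ => c + d * q⁻¹ ^ 2) atTop (𝓝 (c + d * 0 ^ 2)) :=
    tendsto_const_nhds.add ((tendsto_inv_atTop_zero.pow 2).const_mul d)
  have hden : Tendsto (fun q : ℝ => a * q⁻¹ + b * q) atTop atTop :=
    (tendsto_inv_atTop_zero.const_mul a).add_atTop (tendsto_id.const_mul_atTop hb)
  refine (hnum.div_atTop hden).congr' ?_
  filter_upwards [eventually_gt_atTop 0] with q hq
  have h₁ : c + d * q⁻¹ ^ 2 = (c * q + d / q) / q := by field_simp
  have h₂ : a * q⁻¹ + b * q = (a + b * q ^ 2) / q := by field_simp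
  rw [h₁, h₂, div_div_div_cancel_right₀ hq.ne']

/-- The derivative terms `−yᴸ (xᴸ)′ + xᴸ (yᴸ)′` in the normal curvature of a
transverse curve vanish in the limit `L → ∞`. -/
theorem limit_deriv_terms (x y A : ℝ → ℝ) (t₀ : ℝ)
    (hx : DifferentiableAt ℝ x t₀) (hy : DifferentiableAt ℝ y t₀)
    (hA : DifferentiableAt ℝ A t₀) (hy0 : y t₀ ≠ 0) :
    let xL : ℝ → ℝ → ℝ := fun L s =>
      x s / Real.sqrt (x s ^ 2 + y s ^ 2 * (L + A s ^ 2))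
    let yL : ℝ → ℝ → ℝ := fun L s =>
      y s * Real.sqrt (L + A s ^ 2) /
        Real.sqrt (x s ^ 2 + y s ^ 2 * (L + A s ^ 2))
    Tendsto
      (fun L => -(yL L t₀) * deriv (xL L) t₀ + xL L t₀ * deriv (yL L) t₀)
      atTop (𝓝 0) := by
  intro xL yL
  have hq : Tendsto (fun L : ℝ => Real.sqrt (L + A t₀ ^ 2)) atTop atTop :=
    Real.tendsto_sqrt_atTop.comp (tendsto_atTop_add_const_right _ _ tendsto_id)
  have hb : 0 < y t₀ ^ 2 := by positivity
  refine ((tendsto_add_div_div_quadratic_atTop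
    (x t₀ * deriv y t₀ - y t₀ * deriv x t₀) (x t₀ * y t₀ * A t₀ * deriv A t₀)
    (x t₀ ^ 2) hb).comp hq).congr' ?_
  filter_upwards [eventually_gt_atTop 0] with L hL
  have hp : 0 < L + A t₀ ^ 2 := by positivity
  have hD : 0 < x t₀ ^ 2 + y t₀ ^ 2 * (L + A t₀ ^ 2) := by positivity
  have hP : HasDerivAt (fun s => L + A s ^ 2) (2 * A t₀ * deriv A t₀) t₀ := by
    simpa using (hA.hasDerivAt.fun_pow 2).const_add L
  have hv := hy.hasDerivAt.fun_mul (hP.sqrt hp.ne')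
  have hr : DifferentiableAt ℝ
      (fun s => Real.sqrt (x s ^ 2 + y s ^ 2 * (L + A s ^ 2))) t₀ :=
    ((hx.fun_pow 2).fun_add ((hy.fun_pow 2).fun_mul hP.differentiableAt)).sqrt hD.ne'
  have key := wronskian_div_div hx.hasDerivAt hv hr.hasDerivAt (Real.sqrt_pos.2 hD).ne'
  refine Eq.trans ?_ key.symm
  have hs : Real.sqrt (L + A t₀ ^ 2) ≠ 0 := (Real.sqrt_pos.2 hp).ne'
  simp only [Function.comp_apply, Real.sq_sqrt hD.le, Real.sq_sqrt hp.le]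
  congr 1
  field_simp
  ring
end
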